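/- (Theorem 2, mixed operators in Basis Pursuit.) Let A, Φ ∈ ℂ^{m×d} with A ≠ 0, let s ≥ 1, let δ_s and δ_{2s} be restricted isometry constants of A with parameters (s, δ_s) and (2s, δ_{2s}) respectively, with δ_s ≤ δ_{2s} < 1. Define ε_A^{(s)} = ‖A − Φ‖^{(s)}/‖A‖^{(s)}, ε_A^{(2s)} = ‖A − Φ‖^{(2s)}/‖A‖^{(2s)}, ε_A = ‖A − Φ‖₂/‖A‖₂, κ_A^{(s)} = √(1+δ_s)/√(1−δ_s), and γ_A = ‖A‖₂/√(1−δ_s). Assume δ_{2s} < √2/(1 + ε_A^{(2s)})² − 1. Let x ∈ ℂ^d with x_s ≠ 0 satisfy α_s + β_s < 1/κ_A^{(s)}, set b = Ax with b ≠ 0, let e ∈ ℂ^m, y = b + e, and ε_b = ‖e‖₂/‖b‖₂. Define the total noise parameter ε_{A,s,b} = ( (ε_A^{(s)} κ_A^{(s)} + ε_A γ_A α_s)/(1 − κ_A^{(s)}(α_s + β_s)) + ε_b ) ‖b‖₂. Then there exist constants C₀, C₁ > 0, depending only on δ_{2s} and ε_A^{(2s)}, such that any minimizer z⋆ of min ‖z‖₁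 subject to ‖Φz − y‖₂ ≤ ε_{A,s,b} satisfies ‖z⋆ − x‖₂ ≤ (C₀/√s) ‖x − x_s‖₁ + C₁ ε_{A,s,b}. -/

import Mathlib

open scoped BigOperators

/-- The Euclidean (ℓ²) norm of a vector. -/
noncomputable def l2 {n : ℕ} (x : Fin n → ℂ) : ℝ := Real.sqrt (∑ i, ‖x i‖ ^ 2)

/-- The ℓ¹ norm of a vector. -/
noncomputable def l1 {n : ℕ} (x : Fin n → ℂ) : ℝ := ∑ i, ‖x i‖

/-- `x` has at most `s` nonzero entries. -/
def Sparse {n : ℕ} (s : ℕ) (x : Fin n → ℂ) : Prop :=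
  ∃ T : Finset (Fin n), T.card ≤ s ∧ ∀ i ∉ T, x i = 0

/-- `A` satisfies the restricted isometry property with parameters `(s, δ)`. -/
def RIP {m d : ℕ} (A : Matrix (Fin m) (Fin d) ℂ) (s : ℕ) (δ : ℝ) : Prop :=
  ∀ x : Fin d → ℂ, Sparse s x →
    (1 - δ) * (l2 x) ^ 2 ≤ (l2 (A.mulVec x)) ^ 2 ∧
      (l2 (A.mulVec x)) ^ 2 ≤ (1 + δ) * (l2 x) ^ 2

/-- The spectral norm `‖M‖₂` of a matrix. -/
noncomputable def specNorm {m d : ℕ} (M : Matrix (Fin m) (Fin d) ℂ) : ℝ :=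
  sSup {r | ∃ x : Fin d → ℂ, l2 x ≤ 1 ∧ r = l2 (M.mulVec x)}

/-- `‖M‖^{(s)}`: the largest spectral norm over all `s`-column submatrices of `M`,
equivalently the sup of `‖Mx‖₂` over `s`-sparse `x` with `‖x‖₂ ≤ 1`. -/
noncomputable def specNormS {m d : ℕ} (s : ℕ) (M : Matrix (Fin m) (Fin d) ℂ) : ℝ :=
  sSup {r | ∃ x : Fin d → ℂ, Sparse s x ∧ l2 x ≤ 1 ∧ r = l2 (M.mulVec x)}

/-- `xs` is a best `s`-sparse approximation of `x`: it keeps `s` entries of `x` of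
largest magnitude (all entries if `x` has fewer than `s` coordinates) and sets the
others to zero. -/
def IsSparseApprox {n : ℕ} (s : ℕ) (x xs : Fin n → ℂ) : Prop :=
  ∃ T : Finset (Fin n), T.card = min s n ∧
    (∀ i, xs i = if i ∈ T then x i else 0) ∧
    ∀ i ∈ T, ∀ j ∉ T, ‖x j‖ ≤ ‖x i‖

theorem l2_eq_norm {n : ℕ} (x : Fin n → ℂ) : l2 x = ‖WithLp.toLp 2 x‖ := by
  simp [l2, EuclideanSpace.norm_eq]

theorem l2_nonneg {n : ℕ} (x : Fin n → ℂ) : 0 ≤ l2 x := Real.sqrt_nonneg _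

theorem l2_sq {n : ℕ} (x : Fin n → ℂ) : l2 x ^ 2 = ∑ i, ‖x i‖ ^ 2 :=
  Real.sq_sqrt (Finset.sum_nonneg fun _ _ => sq_nonneg _)

theorem l2_add_le {n : ℕ} (x y : Fin n → ℂ) : l2 (x + y) ≤ l2 x + l2 y := by
  simpa only [l2_eq_norm, WithLp.toLp_add] using norm_add_le _ _

theorem l2_smul {n : ℕ} (c : ℂ) (x : Fin n → ℂ) : l2 (c • x) = ‖c‖ * l2 x := by
  simpa only [l2_eq_norm, WithLp.toLp_smul] using norm_smul _ _

@[simp]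
theorem l2_zero {n : ℕ} : l2 (0 : Fin n → ℂ) = 0 := by simp [l2]

theorem l2_neg {n : ℕ} (x : Fin n → ℂ) : l2 (-x) = l2 x := by simp [l2]

theorem l2_sub_le {n : ℕ} (x y : Fin n → ℂ) : l2 (x - y) ≤ l2 x + l2 y := by
  rw [sub_eq_add_neg, ← l2_neg y]
  exact l2_add_le _ _

theorem l2_eq_zero {n : ℕ} {x : Fin n → ℂ} : l2 x = 0 ↔ x = 0 := by
  rw [l2_eq_norm, norm_eq_zero, WithLp.toLp_eq_zero]

theorem l2_pos {n : ℕ} {x : Fin n → ℂ} (hx : x ≠ 0) : 0 < l2 x :=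
  (l2_nonneg x).lt_of_ne' (mt l2_eq_zero.1 hx)

theorem Sparse.smul {n s : ℕ} {x : Fin n → ℂ} (hx : Sparse s x) (c : ℂ) : Sparse s (c • x) := by
  obtain ⟨T, hT, h⟩ := hx
  exact ⟨T, hT, fun i hi => by simp [h i hi]⟩

theorem Sparse.add {n s t : ℕ} {x y : Fin n → ℂ} (hx : Sparse s x) (hy : Sparse t y) :
    Sparse (s + t) (x + y) := by
  obtain ⟨T, hT, hx⟩ := hx
  obtain ⟨U, hU, hy⟩ := hy
  refine ⟨T ∪ U, (Finset.card_union_le _ _).trans (add_le_add hT hU), fun i hi => ?_⟩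
  rw [Finset.mem_union, not_or] at hi
  simp [hx i hi.1, hy i hi.2]

theorem sparse_dim {n : ℕ} (x : Fin n → ℂ) : Sparse n x :=
  ⟨Finset.univ, by simp, by simp⟩

theorem sparse_single {n s : ℕ} (hs : 1 ≤ s) (i : Fin n) (c : ℂ) : Sparse s (Pi.single i c) :=
  ⟨{i}, by simpa using hs, fun j hj => by
    rw [Finset.mem_singleton] at hj
    exact Pi.single_eq_of_ne hj _⟩

theorem sparse_indicator {n s : ℕ} {T : Finset (Fin n)} (hT : T.card ≤ s) (x : Fin n → ℂ) :
    Sparse s ((T : Set (Fin n)).indicator x) :=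
  ⟨T, hT, fun i hi => by simp [hi]⟩

theorem exists_l2_mulVec_le {m d : ℕ} (M : Matrix (Fin m) (Fin d) ℂ) :
    ∃ C, 0 ≤ C ∧ ∀ x, l2 (M.mulVec x) ≤ C * l2 x := by
  refine ⟨_, norm_nonneg (Matrix.toEuclideanLin M).toContinuousLinearMap, fun x => ?_⟩
  rw [l2_eq_norm, l2_eq_norm]
  exact (Matrix.toEuclideanLin M).toContinuousLinearMap.le_opNorm (WithLp.toLp 2 x)

theorem bddAbove_specNormS {m d : ℕ} (s : ℕ) (M : Matrix (Fin m) (Fin d) ℂ) :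
    BddAbove {r | ∃ x : Fin d → ℂ, Sparse s x ∧ l2 x ≤ 1 ∧ r = l2 (M.mulVec x)} := by
  obtain ⟨C, hC, h⟩ := exists_l2_mulVec_le M
  refine ⟨C, ?_⟩
  rintro _ ⟨x, -, hx, rfl⟩
  exact (h x).trans (mul_le_of_le_one_right hC hx)

theorem l2_mulVec_le_specNormS {m d s : ℕ} (M : Matrix (Fin m) (Fin d) ℂ) {x : Fin d → ℂ}
    (hx : Sparse s x) : l2 (M.mulVec x) ≤ specNormS s M * l2 x := by
  rcases eq_or_ne x 0 with rfl | h0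
  · simp
  have hp := l2_pos h0
  have hn : ‖((l2 x)⁻¹ : ℂ)‖ = (l2 x)⁻¹ := by
    rw [norm_inv, Complex.norm_real, Real.norm_of_nonneg hp.le]
  have h : l2 (M.mulVec (((l2 x)⁻¹ : ℂ) • x)) ≤ specNormS s M := by
    refine le_csSup (bddAbove_specNormS s M) ⟨_, hx.smul _, ?_, rfl⟩
    rw [l2_smul, hn, inv_mul_cancel₀ hp.ne']
  rw [Matrix.mulVec_smul, l2_smul, hn, inv_mul_le_iff₀ hp] at h
  linarith

theorem specNorm_eq_specNormS {m d : ℕ} (M : Matrix (Fin m) (Fin d) ℂ) :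
    specNorm M = specNormS d M := by
  simp [specNorm, specNormS, sparse_dim]

theorem l2_mulVec_le_specNorm {m d : ℕ} (M : Matrix (Fin m) (Fin d) ℂ) (x : Fin d → ℂ) :
    l2 (M.mulVec x) ≤ specNorm M * l2 x := by
  rw [specNorm_eq_specNormS]
  exact l2_mulVec_le_specNormS M (sparse_dim x)

theorem specNormS_nonneg {m d : ℕ} (s : ℕ) (M : Matrix (Fin m) (Fin d) ℂ) :
    0 ≤ specNormS s M :=
  Real.sSup_nonneg (by rintro _ ⟨x, -, -, rfl⟩; exact l2_nonneg _)

theorem specNorm_nonneg {m d : ℕ} (M : Matrix (Fin m) (Fin d) ℂ) : 0 ≤ specNorm M :=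
  specNorm_eq_specNormS M ▸ specNormS_nonneg d M

theorem specNormS_pos {m d s : ℕ} {M : Matrix (Fin m) (Fin d) ℂ} (hM : M ≠ 0) (hs : 1 ≤ s) :
    0 < specNormS s M := by
  refine (specNormS_nonneg s M).lt_of_ne' fun h0 => hM ?_
  ext i j
  have h := l2_mulVec_le_specNormS M (sparse_single hs j 1)
  rw [h0, zero_mul] at h
  have h' := congrFun (l2_eq_zero.1 (h.antisymm (l2_nonneg _))) i
  simpa using h'

theorem specNorm_pos {m d : ℕ} {M : Matrix (Fin m) (Fin d) ℂ} (hM : M ≠ 0) :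
    0 < specNorm M := by
  rw [specNorm_eq_specNormS]
  refine specNormS_pos hM (Nat.one_le_iff_ne_zero.2 ?_)
  rintro rfl
  exact hM (Subsingleton.elim _ _)

theorem RIP.l2_mulVec_le {m d s : ℕ} {A : Matrix (Fin m) (Fin d) ℂ} {δ : ℝ} (hA : RIP A s δ)
    {x : Fin d → ℂ} (hx : Sparse s x) : l2 (A.mulVec x) ≤ √(1 + δ) * l2 x := by
  rw [← Real.sqrt_sq (l2_nonneg x), ← Real.sqrt_mul' _ (sq_nonneg _)]
  exact Real.le_sqrt_of_sq_le (hA x hx).2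

theorem RIP.le_l2_mulVec {m d s : ℕ} {A : Matrix (Fin m) (Fin d) ℂ} {δ : ℝ} (hA : RIP A s δ)
    {x : Fin d → ℂ} (hx : Sparse s x) : √(1 - δ) * l2 x ≤ l2 (A.mulVec x) := by
  rw [← Real.sqrt_sq (l2_nonneg x), ← Real.sqrt_mul' _ (sq_nonneg _)]
  exact Real.sqrt_le_iff.2 ⟨l2_nonneg _, (hA x hx).1⟩

theorem RIP.specNormS_le {m d s : ℕ} {A : Matrix (Fin m) (Fin d) ℂ} {δ : ℝ} (hA : RIP A s δ) :
    specNormS s A ≤ √(1 + δ) := by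
  refine Real.sSup_le ?_ (Real.sqrt_nonneg _)
  rintro _ ⟨x, hx, h1, rfl⟩
  exact (hA.l2_mulVec_le hx).trans (mul_le_of_le_one_right (Real.sqrt_nonneg _) h1)

theorem RIP.nonneg {m d s : ℕ} {A : Matrix (Fin m) (Fin d) ℂ} {δ : ℝ} (hA : RIP A s δ)
    (hs : 1 ≤ s) (h0 : A ≠ 0) : 0 ≤ δ := by
  have hd : d ≠ 0 := by
    rintro rfl
    exact h0 (Subsingleton.elim _ _)
  have h := hA _ (sparse_single hs ⟨0, Nat.pos_of_ne_zero hd⟩ 1)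
  have hx := l2_pos (x := Pi.single (⟨0, Nat.pos_of_ne_zero hd⟩ : Fin d) (1 : ℂ)) (by simp)
  nlinarith [h.1.trans h.2, pow_pos hx 2]

/-- A perturbation of a matrix with the RIP, small relative to `‖A‖^{(s)}`, has the RIP. -/
theorem RIP.perturb {m d s : ℕ} {A Φ : Matrix (Fin m) (Fin d) ℂ} {δ ε : ℝ} (hA : RIP A s δ)
    (hδ : 0 ≤ δ) (hε : 0 ≤ ε) (hAΦ : specNormS s (A - Φ) ≤ ε * specNormS s A)
    (hlt : (1 + δ) * (1 + ε) ^ 2 < √2) : RIP Φ s ((1 + δ) * (1 + ε) ^ 2 - 1) := by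
  intro x hx
  have h2 : √2 < 1.415 := by
    rw [Real.sqrt_lt' (by norm_num)]; norm_num
  have hδε : 0 ≤ (1 + δ) * ε := by positivity
  have hδε' : 0 ≤ (1 + δ) * ε ^ 2 := by positivity
  have hδ1 : δ < 1 := by nlinarith
  set p := √(1 + δ)
  set q := √(1 - δ)
  have hp : p ^ 2 = 1 + δ := Real.sq_sqrt (by linarith)
  have hq : q ^ 2 = 1 - δ := Real.sq_sqrt (by linarith)
  have hp0 : 0 ≤ p := Real.sqrt_nonneg _
  have hq0 : 0 ≤ q := Real.sqrt_nonneg _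
  have hqp : q ≤ p := Real.sqrt_le_sqrt (by linarith)
  have hl := l2_nonneg x
  have hE : l2 ((A - Φ).mulVec x) ≤ ε * p * l2 x :=
    (l2_mulVec_le_specNormS _ hx).trans (mul_le_mul_of_nonneg_right
      (hAΦ.trans (mul_le_mul_of_nonneg_left hA.specNormS_le hε)) hl)
  have hEA : (A - Φ).mulVec x = A.mulVec x - Φ.mulVec x := Matrix.sub_mulVec _ _ _
  have hup : l2 (Φ.mulVec x) ≤ p * (1 + ε) * l2 x := by
    have := l2_sub_le (A.mulVec x) ((A - Φ).mulVec x)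
    rw [hEA, sub_sub_cancel, ← hEA] at this
    linarith [hA.l2_mulVec_le hx]
  have hlow : (q - ε * p) * l2 x ≤ l2 (Φ.mulVec x) := by
    have := l2_add_le ((A - Φ).mulVec x) (Φ.mulVec x)
    rw [hEA, sub_add_cancel, ← hEA] at this
    linarith [hA.le_l2_mulVec hx]
  have hεq : ε * p ≤ q := by
    refine le_of_sq_le_sq ?_ hq0
    rw [mul_pow, hp, hq]
    nlinarith
  constructor
  · refine le_trans ?_ (pow_le_pow_left₀ (mul_nonneg (sub_nonneg.2 hεq) hl) hlow 2)
    rw [mul_pow]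
    refine mul_le_mul_of_nonneg_right ?_ (sq_nonneg _)
    nlinarith [mul_nonneg hε (mul_nonneg hp0 (sub_nonneg.2 hqp))]
  · refine (pow_le_pow_left₀ (l2_nonneg _) hup 2).trans_eq ?_
    rw [mul_pow, mul_pow, hp]
    ring

/-- The image under a RIP matrix of vectors with disjoint sparse supports is nearly orthogonal. -/
theorem RIP.neg_re_inner_le {m d s t : ℕ} {A : Matrix (Fin m) (Fin d) ℂ} {δ : ℝ}
    (hA : RIP A (s + t) δ) {u v : Fin d → ℂ} (hu : Sparse s u) (hv : Sparse t v)
    (huv : ∀ i, u i = 0 ∨ v i = 0) :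
    -(inner ℂ (WithLp.toLp 2 (A.mulVec u)) (WithLp.toLp 2 (A.mulVec v))).re
      ≤ δ * l2 u * l2 v := by
  rcases eq_or_ne u 0 with rfl | hu0
  · simp
  rcases eq_or_ne v 0 with rfl | hv0
  · simp
  have hpu := l2_pos hu0
  have hpv := l2_pos hv0
  have hsq : ∀ c : ℂ, l2 ((l2 v : ℂ) • u + (c * l2 u) • v) ^ 2
      = (1 + ‖c‖ ^ 2) * (l2 u * l2 v) ^ 2 := by
    intro c
    have : ∀ i, ‖((l2 v : ℂ) • u + (c * l2 u) • v) i‖ ^ 2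
        = l2 v ^ 2 * ‖u i‖ ^ 2 + ‖c‖ ^ 2 * l2 u ^ 2 * ‖v i‖ ^ 2 := by
      intro i
      rcases huv i with h | h <;> simp [h, mul_pow]
    rw [l2_sq, Finset.sum_congr rfl fun i _ => this i, Finset.sum_add_distrib,
      ← Finset.mul_sum, ← Finset.mul_sum, ← l2_sq, ← l2_sq]
    ring
  have hA1 := (hA _ ((hu.smul (l2 v : ℂ)).add (hv.smul (1 * l2 u : ℂ)))).1
  have hA2 := (hA _ ((hu.smul (l2 v : ℂ)).add (hv.smul (-1 * l2 u : ℂ)))).2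
  rw [hsq] at hA1 hA2
  have hexp : ∀ c : ℝ, l2 (A.mulVec ((l2 v : ℂ) • u + ((c : ℂ) * l2 u) • v)) ^ 2
      = l2 v ^ 2 * l2 (A.mulVec u) ^ 2 + 2 * (c * (l2 u * l2 v)
        * (inner ℂ (WithLp.toLp 2 (A.mulVec u)) (WithLp.toLp 2 (A.mulVec v))).re)
        + c ^ 2 * l2 u ^ 2 * l2 (A.mulVec v) ^ 2 := by
    intro c
    rw [Matrix.mulVec_add, Matrix.mulVec_smul, Matrix.mulVec_smul, l2_eq_norm (_ + _),
      WithLp.toLp_add, @norm_add_sq ℂ, WithLp.toLp_smul, WithLp.toLp_smul, norm_smul, norm_smul,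
      ← l2_eq_norm, ← l2_eq_norm, inner_smul_left, inner_smul_right]
    simp [mul_pow]
    ring
  have h1 := hexp 1
  have h2 := hexp (-1)
  push_cast at h1 h2
  rw [h1] at hA1
  rw [h2] at hA2
  norm_num at hA1 hA2
  have hP := mul_pos hpu hpv
  refine le_of_mul_le_mul_left ?_ hP
  nlinarith

theorem l2_indicator_sq {n : ℕ} (T : Finset (Fin n)) (x : Fin n → ℂ) :
    l2 ((T : Set (Fin n)).indicator x) ^ 2 = ∑ i ∈ T, ‖x i‖ ^ 2 := by
  rw [l2_sq, ← Finset.sum_subset (Finset.subset_univ T) fun i _ hi => by simp [hi]]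
  exact Finset.sum_congr rfl fun i hi => by simp [hi]

theorem l2_indicator_le {n : ℕ} (T : Set (Fin n)) (x : Fin n → ℂ) :
    l2 (T.indicator x) ≤ l2 x :=
  Real.sqrt_le_sqrt <| Finset.sum_le_sum fun i _ =>
    pow_le_pow_left₀ (norm_nonneg _) (norm_indicator_le_norm_self x i) 2

theorem indicator_eq_add_sdiff {n : ℕ} {T S : Finset (Fin n)} (h : T ⊆ S) (x : Fin n → ℂ) :
    (S : Set (Fin n)).indicator x = (T : Set (Fin n)).indicator x
      + ((S \ T : Finset (Fin n)) : Set (Fin n)).indicator x := by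
  ext i
  by_cases hT : i ∈ T
  · simp [hT, h hT]
  · by_cases hS : i ∈ S <;> simp [hT, hS]

theorem sum_norm_le_sqrt_mul_l2 {n s : ℕ} {T : Finset (Fin n)} (hT : T.card ≤ s)
    (x : Fin n → ℂ) : ∑ i ∈ T, ‖x i‖ ≤ √s * l2 ((T : Set (Fin n)).indicator x) := by
  rw [← Real.sqrt_sq (l2_nonneg _), ← Real.sqrt_mul (Nat.cast_nonneg s), l2_indicator_sq]
  refine Real.le_sqrt_of_sq_le (sq_sum_le_card_mul_sum_sq.trans ?_)
  exact mul_le_mul_of_nonneg_right (by exact_mod_cast hT)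
    (Finset.sum_nonneg fun _ _ => sq_nonneg _)

theorem exists_subset_card_eq_largest {α : Type*} [DecidableEq α] (g : α → ℝ) (S : Finset α)
    (s : ℕ) (hs : s ≤ S.card) :
    ∃ T ⊆ S, T.card = s ∧ ∀ i ∈ T, ∀ j ∈ S \ T, g j ≤ g i := by
  induction s with
  | zero => exact ⟨∅, by simp⟩
  | succ s ih =>
    obtain ⟨T, hTS, hT, h⟩ := ih (by omega)
    have hne : (S \ T).Nonempty := by
      rw [← Finset.card_pos, Finset.card_sdiff_of_subset hTS]
      omega
    obtain ⟨k, hk, hmax⟩ := Finset.exists_max_image (S \ T) g hne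
    have hk' := Finset.mem_sdiff.1 hk
    refine ⟨insert k T, Finset.insert_subset hk'.1 hTS, by simp [hk'.2, hT], ?_⟩
    intro i hi j hj
    simp only [Finset.mem_sdiff, Finset.mem_insert, not_or] at hi hj
    have hj' : j ∈ S \ T := Finset.mem_sdiff.2 ⟨hj.1, hj.2.2⟩
    rcases hi with rfl | hi
    · exact hmax j hj'
    · exact h i hi j hj'

/-- Splitting `x` into blocks of size `s` of decreasing magnitude: a subadditive functional that
is controlled by `K * l2` on `s`-element blocks is controlled by `K / √s * l1` off the block of
the largest entries. -/
theorem exists_block_bound {n s : ℕ} (hs : 1 ≤ s) (x : Fin n → ℂ) (S : Finset (Fin n)) :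
    ∃ T ⊆ S, T.card ≤ s ∧
      ∀ (f : (Fin n → ℂ) → ℝ) (K : ℝ), 0 ≤ K → f 0 ≤ 0 → (∀ u v, f (u + v) ≤ f u + f v) →
        (∀ P ⊆ S \ T, P.card ≤ s → f ((P : Set (Fin n)).indicator x)
          ≤ K * l2 ((P : Set (Fin n)).indicator x)) →
        √s * f (((S \ T : Finset (Fin n)) : Set (Fin n)).indicator x)
          ≤ K * ∑ i ∈ S, ‖x i‖ := by
  induction hn : S.card using Nat.strong_induction_on generalizing S with
  | _ k ih =>
  rcases le_or_gt S.card s with hle | hgt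
  · refine ⟨S, subset_rfl, hle, fun f K hK h0 _ _ => ?_⟩
    simp only [Finset.sdiff_self, Finset.coe_empty, Set.indicator_empty]
    exact (mul_nonpos_of_nonneg_of_nonpos (Real.sqrt_nonneg _) h0).trans
      (mul_nonneg hK (Finset.sum_nonneg fun _ _ => norm_nonneg _))
  obtain ⟨T, hTS, hT, hmax⟩ := exists_subset_card_eq_largest (fun i => ‖x i‖) S s hgt.le
  obtain ⟨T', hTS', hT', hf⟩ := ih (S \ T).card
    (by rw [Finset.card_sdiff_of_subset hTS]; omega) (S \ T) rfl
  refine ⟨T, hTS, hT.le, fun f K hK h0 hadd hP => ?_⟩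
  have hrest := hf f K hK h0 hadd fun P hPS => hP P (hPS.trans Finset.sdiff_subset)
  have hfirst := hP T' hTS' hT'
  have hs0 : (0 : ℝ) < s := by exact_mod_cast hs
  have hblock : √s * l2 ((T' : Set (Fin n)).indicator x) ≤ ∑ i ∈ T, ‖x i‖ := by
    have hsum : 0 ≤ ∑ i ∈ T, ‖x i‖ := Finset.sum_nonneg fun _ _ => norm_nonneg _
    refine le_of_sq_le_sq ?_ hsum
    rw [mul_pow, Real.sq_sqrt hs0.le, l2_indicator_sq]
    have hle : ∀ j ∈ T', s * ‖x j‖ ≤ ∑ i ∈ T, ‖x i‖ := by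
      intro j hj
      have := Finset.card_nsmul_le_sum T (fun i => ‖x i‖) ‖x j‖
        fun i hi => hmax i hi j (hTS' hj)
      simpa [hT] using this
    have hsq : ∑ j ∈ T', (s * ‖x j‖) ^ 2 ≤ s * (∑ i ∈ T, ‖x i‖) ^ 2 := by
      refine (Finset.sum_le_card_nsmul T' _ _ fun j hj =>
        pow_le_pow_left₀ (by positivity) (hle j hj) 2).trans ?_
      rw [nsmul_eq_mul]
      exact mul_le_mul_of_nonneg_right (by exact_mod_cast hT') (sq_nonneg _)
    simp only [mul_pow, ← Finset.mul_sum] at hsq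
    refine le_of_mul_le_mul_left ?_ hs0
    linarith
  rw [← Finset.sum_sdiff hTS, indicator_eq_add_sdiff hTS' x]
  have hh := mul_le_mul_of_nonneg_left ((hadd ((T' : Set (Fin n)).indicator x)
    ((((S \ T) \ T' : Finset (Fin n)) : Set (Fin n)).indicator x)).trans
      (add_le_add hfirst le_rfl))
    (Real.sqrt_nonneg (s : ℝ))
  have hb := mul_le_mul_of_nonneg_left hblock hK
  linarith

theorem RIP.sqrt_mul_l2_mulVec_le {m d s : ℕ} {A : Matrix (Fin m) (Fin d) ℂ} {δ : ℝ}
    (hA : RIP A s δ) (hs : 1 ≤ s) (x : Fin d → ℂ) :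
    √s * l2 (A.mulVec x) ≤ √(1 + δ) * (√s * l2 x + l1 x) := by
  obtain ⟨T, hTS, hT, hf⟩ := exists_block_bound hs x Finset.univ
  have h2 := hf (fun v => l2 (A.mulVec v)) √(1 + δ) (Real.sqrt_nonneg _) (by simp)
    (fun u v => by rw [Matrix.mulVec_add]; exact l2_add_le (A.mulVec u) (A.mulVec v))
    (fun P _ hP => hA.l2_mulVec_le (sparse_indicator hP x))
  have h1 : l2 (A.mulVec ((T : Set (Fin d)).indicator x)) ≤ √(1 + δ) * l2 x :=
    (hA.l2_mulVec_le (sparse_indicator hT x)).trans (mul_le_mul_of_nonneg_left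
      (l2_indicator_le (T : Set (Fin d)) x) (Real.sqrt_nonneg _))
  have hx := indicator_eq_add_sdiff hTS x
  rw [Finset.coe_univ, Set.indicator_univ] at hx
  have h3 := l2_add_le (A.mulVec ((T : Set (Fin d)).indicator x))
    (A.mulVec (((Finset.univ \ T : Finset (Fin d)) : Set (Fin d)).indicator x))
  rw [← Matrix.mulVec_add, ← hx] at h3
  have h4 := mul_le_mul_of_nonneg_left (h3.trans (add_le_add h1 le_rfl))
    (Real.sqrt_nonneg (s : ℝ))
  unfold l1
  linarith

theorem sum_compl_norm_sub_le {d : ℕ} {x z : Fin d → ℂ} (hz : l1 z ≤ l1 x)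
    (T : Finset (Fin d)) :
    ∑ i ∈ Tᶜ, ‖(z - x) i‖ ≤ ∑ i ∈ T, ‖(z - x) i‖ + 2 * ∑ i ∈ Tᶜ, ‖x i‖ := by
  unfold l1 at hz
  rw [← Finset.sum_add_sum_compl T, ← Finset.sum_add_sum_compl T] at hz
  have h1 : ∑ i ∈ T, ‖x i‖ ≤ ∑ i ∈ T, ‖(z - x) i‖ + ∑ i ∈ T, ‖z i‖ := by
    rw [← Finset.sum_add_distrib]
    refine Finset.sum_le_sum fun i _ => ?_
    rw [Pi.sub_apply, norm_sub_rev]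
    exact norm_le_norm_sub_add _ _
  have h2 : ∑ i ∈ Tᶜ, ‖(z - x) i‖ ≤ ∑ i ∈ Tᶜ, ‖z i‖ + ∑ i ∈ Tᶜ, ‖x i‖ := by
    rw [← Finset.sum_add_distrib]
    exact Finset.sum_le_sum fun i _ => norm_sub_le _ _
  linarith

/-- Stability of `ℓ¹`-minimization under the RIP with `δ₂ₛ < √2 - 1`. -/
theorem RIP.l2_sub_le_of_l1_le {m d s : ℕ} {Φ : Matrix (Fin m) (Fin d) ℂ} {δ η : ℝ}
    (hΦ : RIP Φ (2 * s) δ) (hδ0 : 0 ≤ δ) (hδ : δ < √2 - 1) (hs : 1 ≤ s) {T : Finset (Fin d)}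
    (hT : T.card ≤ s) {x z : Fin d → ℂ} (hz : l1 z ≤ l1 x)
    (hη : l2 (Φ.mulVec (z - x)) ≤ 2 * η) :
    l2 (z - x) ≤ (2 + 4 * √2 * δ / (1 - (1 + √2) * δ)) / √s * ∑ i ∈ Tᶜ, ‖x i‖
      + 4 * √(1 + δ) / (1 - (1 + √2) * δ) * η := by
  have hcone := sum_compl_norm_sub_le hz T
  set h := z - x
  obtain ⟨T₁, hT₁c, hT₁, hf⟩ := exists_block_bound hs h Tᶜ
  have hdisj : Disjoint T T₁ := disjoint_compl_right.mono_right hT₁c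
  set u := (T : Set (Fin d)).indicator h with hu
  set v := (T₁ : Set (Fin d)).indicator h with hv
  set w := ((Tᶜ \ T₁ : Finset (Fin d)) : Set (Fin d)).indicator h with hw
  set E := ∑ i ∈ Tᶜ, ‖x i‖
  set σ := ∑ i ∈ Tᶜ, ‖h i‖
  set p := √(1 + δ)
  have hsplit : h = u + v + w := by
    have h1 := indicator_eq_add_sdiff (Finset.subset_univ T) h
    rw [Finset.coe_univ, Set.indicator_univ, ← Finset.compl_eq_univ_sdiff,
      indicator_eq_add_sdiff hT₁c h] at h1
    rw [add_assoc]
    exact h1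
  have huv : l2 (u + v) ^ 2 = l2 u ^ 2 + l2 v ^ 2 := by
    have : u + v = ((T ∪ T₁ : Finset (Fin d)) : Set (Fin d)).indicator h := by
      rw [indicator_eq_add_sdiff (Finset.subset_union_left (s₁ := T) (s₂ := T₁)) h,
        Finset.union_sdiff_cancel_left hdisj]
    rw [this, hu, hv, l2_indicator_sq, l2_indicator_sq, l2_indicator_sq,
      Finset.sum_union hdisj]
  have hsu : Sparse s u := sparse_indicator hT h
  have hsv : Sparse s v := sparse_indicator hT₁ h
  have hsuv : Sparse (2 * s) (u + v) := two_mul s ▸ hsu.add hsv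
  have hu0 := l2_nonneg u
  have hv0 := l2_nonneg v
  set a := l2 (u + v) with ha
  have ha0 : 0 ≤ a := l2_nonneg _
  have hua : l2 u ≤ a := le_of_sq_le_sq (by rw [huv]; nlinarith) ha0
  have h2 : √2 ^ 2 = 2 := Real.sq_sqrt (by norm_num)
  have h20 : 0 ≤ √2 := Real.sqrt_nonneg _
  have huva : l2 u + l2 v ≤ √2 * a := by
    refine le_of_sq_le_sq ?_ (by positivity)
    rw [mul_pow, h2, huv]
    nlinarith [sq_nonneg (l2 u - l2 v)]
  have hr : 0 < √s := Real.sqrt_pos.2 (by exact_mod_cast hs)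
  set r := √(s : ℝ)
  have hp0 : 0 ≤ p := Real.sqrt_nonneg _
  have hη0 : 0 ≤ η := by linarith [l2_nonneg (Φ.mulVec h)]
  have hE0 : 0 ≤ E := Finset.sum_nonneg fun _ _ => norm_nonneg _
  have hσ : σ ≤ r * a + 2 * E := by
    have := (sum_norm_le_sqrt_mul_l2 hT h).trans (mul_le_mul_of_nonneg_left hua hr.le)
    linarith
  have hwσ : r * l2 w ≤ σ := by
    have := hf l2 1 zero_le_one (by simp) l2_add_le fun P _ _ => by rw [one_mul]
    rwa [one_mul] at this
  have hcross := hf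
    (fun y => -(inner ℂ (WithLp.toLp 2 (Φ.mulVec (u + v))) (WithLp.toLp 2 (Φ.mulVec y))).re)
    (δ * (√2 * a)) (by positivity) (by simp)
    (fun y y' => by
      rw [Matrix.mulVec_add _ y y', WithLp.toLp_add 2 (Φ.mulVec y), inner_add_right,
        Complex.add_re, neg_add])
    (fun P hP hPs => by
      have hsP : Sparse s ((P : Set (Fin d)).indicator h) := sparse_indicator hPs h
      have hPT : ∀ i ∈ P, i ∉ T ∧ i ∉ T₁ := fun i hi => by simpa using hP hi
      rw [two_mul] at hΦ
      have e1 := hΦ.neg_re_inner_le hsu hsP fun i => by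
        by_cases hi : i ∈ P
        · exact Or.inl (by simp [hu, (hPT i hi).1])
        · exact Or.inr (by simp [hi])
      have e2 := hΦ.neg_re_inner_le hsv hsP fun i => by
        by_cases hi : i ∈ P
        · exact Or.inl (by simp [hv, (hPT i hi).2])
        · exact Or.inr (by simp [hi])
      have e3 := mul_le_mul_of_nonneg_right (mul_le_mul_of_nonneg_left huva hδ0)
        (l2_nonneg ((P : Set (Fin d)).indicator h))
      rw [Matrix.mulVec_add, WithLp.toLp_add, inner_add_left, Complex.add_re]
      linarith)
  have hinner : (inner ℂ (WithLp.toLp 2 (Φ.mulVec (u + v))) (WithLp.toLp 2 (Φ.mulVec h))).re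
      = l2 (Φ.mulVec (u + v)) ^ 2
        + (inner ℂ (WithLp.toLp 2 (Φ.mulVec (u + v))) (WithLp.toLp 2 (Φ.mulVec w))).re := by
    conv_lhs => rw [hsplit, Matrix.mulVec_add _ (u + v) w, WithLp.toLp_add, inner_add_right,
      Complex.add_re]
    rw [l2_eq_norm, ← @inner_self_eq_norm_sq ℂ]
    rfl
  have hCS : (inner ℂ (WithLp.toLp 2 (Φ.mulVec (u + v))) (WithLp.toLp 2 (Φ.mulVec h))).re
      ≤ p * a * (2 * η) := by
    refine (Complex.re_le_norm _).trans ((norm_inner_le_norm _ _).trans ?_)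
    rw [← l2_eq_norm, ← l2_eq_norm]
    exact mul_le_mul (hΦ.l2_mulVec_le hsuv) hη (l2_nonneg _) (by positivity)
  have hlow := (hΦ _ hsuv).1
  rw [← ha] at hlow
  have hmain : a * (r * ((1 - δ) * a)) ≤ a * (r * (2 * p * η) + √2 * δ * σ) := by
    have := mul_le_mul_of_nonneg_left
      (hlow.trans ((eq_sub_of_add_eq hinner.symm).le.trans (sub_le_sub_right hCS _))) hr.le
    linarith
  have hδ1 : 0 < 1 - (1 + √2) * δ := by nlinarith
  set ρ := 1 - (1 + √2) * δ with hρ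
  have hbound : r * (ρ * a) ≤ 2 * r * p * η + 2 * √2 * δ * E := by
    rcases ha0.eq_or_lt with h0 | h0
    · rw [← h0, mul_zero, mul_zero]
      positivity
    · have h3 := le_of_mul_le_mul_left hmain h0
      have h4 := mul_le_mul_of_nonneg_left hσ (mul_nonneg h20 hδ0)
      rw [hρ]
      linarith
  have htri : r * l2 h ≤ 2 * (r * a) + 2 * E := by
    have := mul_le_mul_of_nonneg_left (l2_add_le (u + v) w) hr.le
    rw [← hsplit, ← ha] at this
    linarith
  refine le_of_mul_le_mul_left ?_ (mul_pos hr hδ1)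
  have hrhs : r * ρ * ((2 + 4 * √2 * δ / ρ) / r * E + 4 * p / ρ * η)
      = ρ * (2 * E) + 4 * √2 * δ * E + 4 * r * p * η := by
    field_simp
  rw [hrhs]
  have := mul_le_mul_of_nonneg_left htri hδ1.le
  linarith

/-- The relative size of the perturbation `(A - Φ) x`, in terms of how compressible `x` is. -/
theorem l2_perturbation_le {m d s : ℕ} {A Φ : Matrix (Fin m) (Fin d) ℂ} {δ : ℝ} (hA : A ≠ 0)
    (hs : 1 ≤ s) (hR : RIP A s δ) (hδ : δ < 1) {x xs : Fin d → ℂ} (hxs : Sparse s xs)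
    (hxs0 : xs ≠ 0)
    (hαβ : l2 (x - xs) / l2 xs + l1 (x - xs) / (√s * l2 xs) < √(1 - δ) / √(1 + δ)) :
    l2 ((A - Φ).mulVec x) ≤
      (specNormS s (A - Φ) / specNormS s A * (√(1 + δ) / √(1 - δ))
        + specNorm (A - Φ) / specNorm A * (specNorm A / √(1 - δ)) * (l2 (x - xs) / l2 xs))
      / (1 - √(1 + δ) / √(1 - δ) * (l2 (x - xs) / l2 xs + l1 (x - xs) / (√s * l2 xs)))
      * l2 (A.mulVec x) := by
  have hδ0 := hR.nonneg hs hA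
  have hp : 0 < √(1 + δ) := Real.sqrt_pos.2 (by linarith)
  have hq : 0 < √(1 - δ) := Real.sqrt_pos.2 (by linarith)
  have hr : 0 < √(s : ℝ) := Real.sqrt_pos.2 (by exact_mod_cast hs)
  have hn := l2_pos hxs0
  have hSp := hR.specNormS_le
  have hS := specNormS_pos hA hs
  have hN := specNorm_pos hA
  have hSE := specNormS_nonneg s (A - Φ)
  have hup : l2 ((A - Φ).mulVec x)
      ≤ specNormS s (A - Φ) * l2 xs + specNorm (A - Φ) * l2 (x - xs) := by
    have h := l2_add_le ((A - Φ).mulVec xs) ((A - Φ).mulVec (x - xs))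
    rw [← Matrix.mulVec_add, add_sub_cancel] at h
    exact h.trans (add_le_add (l2_mulVec_le_specNormS _ hxs) (l2_mulVec_le_specNorm _ _))
  have hlow : √s * (√(1 - δ) * l2 xs)
      ≤ √s * l2 (A.mulVec x) + √(1 + δ) * (√s * l2 (x - xs) + l1 (x - xs)) := by
    have h := l2_sub_le (A.mulVec x) (A.mulVec (x - xs))
    rw [← Matrix.mulVec_sub, sub_sub_cancel] at h
    have h' := mul_le_mul_of_nonneg_left ((hR.le_l2_mulVec hxs).trans h) hr.le
    linarith [hR.sqrt_mul_l2_mulVec_le hs (x - xs)]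
  set p := √(1 + δ)
  set q := √(1 - δ)
  set r := √(s : ℝ)
  set n := l2 xs
  set t := l2 (x - xs)
  set o := l1 (x - xs)
  set S := specNormS s A
  set N := specNorm A
  set b := l2 (A.mulVec x)
  have hD : 0 < 1 - p / q * (t / n + o / (r * n)) := by
    have := mul_lt_mul_of_pos_left hαβ (div_pos hp hq)
    rw [div_mul_div_cancel₀ hq.ne', div_self hp.ne'] at this
    linarith
  have hDb : (1 - p / q * (t / n + o / (r * n))) * (q * n) ≤ b := by
    refine le_of_mul_le_mul_left ?_ hr
    have : r * ((1 - p / q * (t / n + o / (r * n))) * (q * n))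
        = r * (q * n) - p * (r * t + o) := by
      field_simp
    rw [this]
    linarith
  set D := 1 - p / q * (t / n + o / (r * n))
  have hnum : specNormS s (A - Φ) * n + specNorm (A - Φ) * t
      ≤ (specNormS s (A - Φ) / S * (p / q) + specNorm (A - Φ) / N * (N / q) * (t / n))
        * (q * n) := by
    have h1 : (specNormS s (A - Φ) / S * (p / q) + specNorm (A - Φ) / N * (N / q) * (t / n))
        * (q * n) = specNormS s (A - Φ) * n * (p / S) + specNorm (A - Φ) * t := by
      field_simp
    rw [h1]
    exact add_le_add (le_mul_of_one_le_right (by positivity) ((one_le_div hS).2 hSp)) le_rfl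
  have hNE := specNorm_nonneg (A - Φ)
  have ht0 : 0 ≤ t := l2_nonneg _
  refine hup.trans (hnum.trans ?_)
  rw [div_mul_eq_mul_div _ D b, le_div_iff₀ hD, mul_assoc]
  refine mul_le_mul_of_nonneg_left ?_ (by positivity)
  linarith

/-- Theorem 2 (Herman–Strohmer): mixed operators in Basis Pursuit.  The constants
`C₀, C₁` depend only on `δ2s` and `ε2s = ε_A^{(2s)}`. -/
theorem bp_mixed_operators (δ2s ε2s : ℝ) (hδ2s1 : δ2s < 1)
    (hδ2s : δ2s < Real.sqrt 2 / (1 + ε2s) ^ 2 - 1) :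
    ∃ C₀ C₁ : ℝ, 0 < C₀ ∧ 0 < C₁ ∧
      ∀ (m d s : ℕ), 1 ≤ s →
      ∀ (A Φ : Matrix (Fin m) (Fin d) ℂ), A ≠ 0 →
      ∀ δs : ℝ, RIP A s δs → RIP A (2 * s) δ2s → δs ≤ δ2s →
      -- `ε_A^{(2s)} = ‖A - Φ‖^{(2s)} / ‖A‖^{(2s)}`
      specNormS (2 * s) (A - Φ) / specNormS (2 * s) A = ε2s →
      ∀ (x xs : Fin d → ℂ), IsSparseApprox s x xs → xs ≠ 0 →
      -- `α_s + β_s < 1 / κ_A^{(s)}`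
      l2 (x - xs) / l2 xs + l1 (x - xs) / (Real.sqrt s * l2 xs)
          < Real.sqrt (1 - δs) / Real.sqrt (1 + δs) →
      ∀ e : Fin m → ℂ, A.mulVec x ≠ 0 →
      ∀ tot : ℝ,
      -- the total noise parameter `ε_{A,s,b}`
      tot = ((specNormS s (A - Φ) / specNormS s A
                * (Real.sqrt (1 + δs) / Real.sqrt (1 - δs))
              + specNorm (A - Φ) / specNorm A
                * (specNorm A / Real.sqrt (1 - δs)) * (l2 (x - xs) / l2 xs))
            / (1 - Real.sqrt (1 + δs) / Real.sqrt (1 - δs)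
                * (l2 (x - xs) / l2 xs + l1 (x - xs) / (Real.sqrt s * l2 xs)))
            + l2 e / l2 (A.mulVec x)) * l2 (A.mulVec x) →
      ∀ zstar : Fin d → ℂ,
        -- `zstar` is a minimizer of BP with decoding matrix `Φ`, data `y = b + e`,
        -- and noise level `tot`
        (l2 (Φ.mulVec zstar - (A.mulVec x + e)) ≤ tot ∧
          ∀ z : Fin d → ℂ, l2 (Φ.mulVec z - (A.mulVec x + e)) ≤ tot → l1 zstar ≤ l1 z) →
        l2 (zstar - x) ≤ C₀ / Real.sqrt s * l1 (x - xs) + C₁ * tot := by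
  by_cases hpos : 0 ≤ δ2s ∧ 0 ≤ ε2s
  swap
  · refine ⟨1, 1, one_pos, one_pos, ?_⟩
    intro m d s hs A Φ hA δs hRs hR2s _ hε
    exact absurd ⟨hR2s.nonneg (by omega) hA,
      hε ▸ div_nonneg (specNormS_nonneg _ _) (specNormS_nonneg _ _)⟩ hpos
  obtain ⟨hδ0, hε0⟩ := hpos
  have hlt : (1 + δ2s) * (1 + ε2s) ^ 2 < √2 := by
    rw [← lt_div_iff₀ (by positivity)]
    linarith
  set δ := (1 + δ2s) * (1 + ε2s) ^ 2 - 1 with hδ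
  have hδnonneg : 0 ≤ δ := by nlinarith [mul_nonneg hδ0 (sq_nonneg (1 + ε2s))]
  have hδlt : δ < √2 - 1 := by linarith
  have h2 : √2 ^ 2 = 2 := Real.sq_sqrt (by norm_num)
  have h20 : 0 ≤ √2 := Real.sqrt_nonneg _
  have hρ : 0 < 1 - (1 + √2) * δ := by nlinarith
  refine ⟨2 + 4 * √2 * δ / (1 - (1 + √2) * δ), 4 * √(1 + δ) / (1 - (1 + √2) * δ),
    by positivity, by positivity, ?_⟩
  intro m d s hs A Φ hA δs hRs hR2s hδs hε x xs hxs hxs0 hαβ e hb tot htot z ⟨hz, hmin⟩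
  obtain ⟨T, hTcard, hTx, -⟩ := hxs
  have hT : T.card ≤ s := hTcard.le.trans (min_le_left _ _)
  have hS2 : 0 < specNormS (2 * s) A := specNormS_pos hA (by omega)
  have hΦ : RIP Φ (2 * s) δ :=
    hR2s.perturb hδ0 hε0 ((div_eq_iff hS2.ne').1 hε).le hlt
  have hfeas : l2 (Φ.mulVec x - (A.mulVec x + e)) ≤ tot := by
    have hpert := l2_perturbation_le hA hs hRs (hδs.trans_lt hδ2s1)
      (Φ := Φ) ⟨T, hT, fun i hi => by rw [hTx, if_neg hi]⟩ hxs0 hαβ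
    have htri := l2_sub_le (-((A - Φ).mulVec x)) e
    rw [l2_neg, Matrix.sub_mulVec, neg_sub, sub_sub] at htri
    rw [htot, add_mul, div_mul_cancel₀ _ (l2_pos hb).ne']
    rw [Matrix.sub_mulVec] at hpert
    exact htri.trans (add_le_add hpert le_rfl)
  have hη : l2 (Φ.mulVec (z - x)) ≤ 2 * tot := by
    have htri := l2_sub_le (Φ.mulVec z - (A.mulVec x + e)) (Φ.mulVec x - (A.mulVec x + e))
    rw [sub_sub_sub_cancel_right, ← Matrix.mulVec_sub] at htri
    linarith
  have htail : l1 (x - xs) = ∑ i ∈ Tᶜ, ‖x i‖ := by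
    unfold l1
    rw [← Finset.sum_subset (Finset.subset_univ Tᶜ)]
    · exact Finset.sum_congr rfl fun i hi => by simp [hTx, Finset.mem_compl.1 hi]
    · intro i _ hi
      simp [hTx, not_not.1 (mt Finset.mem_compl.2 hi)]
  rw [htail]
  exact hΦ.l2_sub_le_of_l1_le hδnonneg hδlt hs hT (hmin x hfeas) hη
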